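/- Let I be an ideal on ω and f ∈ ℓ∞' with f(e) = 0, ‖f‖ ≤ 2, and f(𝟙_A) = 0 for all A ∈ I. The decomposition f = g − h with g, h ∈ SL(I) is unique if and only if ‖f‖ = 2 or I is maximal. -/

import Mathlib

open Filter Topology

noncomputable section

abbrev LInf : Type := lp (fun _ : ℕ => ℝ) (⊤ : ENNReal)

def indic (A : Set ℕ) : LInf :=
  ⟨A.indicator (fun _ => (1:ℝ)), memℓp_infty ⟨1, by
    rintro r ⟨n, rfl⟩
    by_cases h : n ∈ A <;> simp [Set.indicator, h]⟩⟩

def IsIdealOmega (I : Set (Set ℕ)) : Prop :=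
  (∀ A B : Set ℕ, A ∈ I → B ⊆ A → B ∈ I) ∧
  (∀ A B : Set ℕ, A ∈ I → B ∈ I → A ∪ B ∈ I) ∧
  (Set.univ : Set ℕ) ∉ I ∧
  (∀ A : Set ℕ, A.Finite → A ∈ I)

def SLI (I : Set (Set ℕ)) : Set (LInf →L[ℝ] ℝ) :=
  {f | (∀ x : LInf, (∀ n, 0 ≤ x n) → 0 ≤ f x) ∧
       (∀ (x : LInf) (a : ℝ), Tendsto (fun n => x n) atTop (𝓝 a) → f x = a) ∧
       (∀ A ∈ I, f (indic A) = 0)}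

def UltI (I : Set (Set ℕ)) : Set (Ultrafilter ℕ) :=
  {F | (↑F : Filter ℕ) ≤ cofinite ∧ ∀ A ∈ I, Aᶜ ∈ F}

def IClusterPoint (I : Set (Set ℕ)) (x : ℕ → ℝ) (η : ℝ) : Prop :=
  ∀ ε > 0, {n | |x n - η| ≤ ε} ∉ I

def IConv (I : Set (Set ℕ)) (x : ℕ → ℝ) (η : ℝ) : Prop :=
  ∀ ε > 0, {n | ε ≤ |x n - η|} ∈ I

def eone : LInf := indic Set.univ


lemma LInf_abs_le (x : LInf) (n : ℕ) : |x n| ≤ ‖x‖ := by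
  have := lp.norm_apply_le_norm (p := (⊤ : ENNReal)) (by simp) x n
  simpa using this

lemma LInf_norm_le (x : LInf) (C : ℝ) (hC : 0 ≤ C) (h : ∀ n, |x n| ≤ C) : ‖x‖ ≤ C :=
  lp.norm_le_of_forall_le hC (fun n => by simpa using h n)

lemma indic_apply (A : Set ℕ) (n : ℕ) : indic A n = A.indicator (fun _ => (1:ℝ)) n := rfl

lemma eone_eq : eone = 1 := by
  ext n
  simp [eone, indic_apply]

lemma LInf_mul_apply (x y : LInf) (n : ℕ) : (x * y) n = x n * y n := by
  simp [lp.infty_coeFn_mul]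

lemma LInf_one_apply (n : ℕ) : (1 : LInf) n = 1 := by
  simp [lp.infty_coeFn_one]

lemma indic_mul (A B : Set ℕ) : indic A * indic B = indic (A ∩ B) := by
  ext n
  rw [LInf_mul_apply]
  simp only [indic_apply, Set.indicator]
  by_cases h1 : n ∈ A <;> by_cases h2 : n ∈ B <;> simp [h1, h2]

lemma indic_compl (A : Set ℕ) : indic Aᶜ = 1 - indic A := by
  ext n
  simp only [lp.coeFn_sub, Pi.sub_apply, LInf_one_apply]
  simp only [indic_apply, Set.indicator]
  by_cases h1 : n ∈ A <;> simp [h1]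

lemma lInf_sum_apply (s : Finset ℤ) (F : ℤ → LInf) (n : ℕ) :
    (∑ k ∈ s, F k) n = ∑ k ∈ s, F k n := by
  classical
  induction s using Finset.induction_on with
  | empty => simp
  | insert a s ha ih => rw [Finset.sum_insert ha, Finset.sum_insert ha, lp.coeFn_add, Pi.add_apply, ih]

lemma clm_eq_zero_of_indic (φ : LInf →L[ℝ] ℝ) (h : ∀ B, φ (indic B) = 0) : φ = 0 := by
  ext x
  rw [ContinuousLinearMap.zero_apply]
  have key : ∀ N : ℕ, |φ x| ≤ ‖φ‖ * (1 / ((N : ℝ) + 1)) := by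
    intro N
    have hN : (0:ℝ) < (N : ℝ) + 1 := by positivity
    obtain ⟨K, hK⟩ := exists_nat_gt (‖x‖ * ((N : ℝ) + 1) + 1)
    let s : LInf := ∑ k ∈ Finset.Icc (-(K:ℤ)) K,
      ((k : ℝ) / ((N : ℝ) + 1)) • indic {n | ⌊x n * ((N : ℝ) + 1)⌋ = k}
    have hs : φ s = 0 := by
      simp only [s, map_sum, map_smul, h, smul_zero, Finset.sum_const_zero]
    have hsn : ∀ n, s n = (⌊x n * ((N : ℝ) + 1)⌋ : ℝ) / ((N : ℝ) + 1) := by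
      intro n
      simp only [s]
      rw [lInf_sum_apply, Finset.sum_eq_single ⌊x n * ((N : ℝ) + 1)⌋]
      · simp [indic_apply]
      · intro b _ hb
        simp [indic_apply, Ne.symm hb]
      · intro hnot
        exfalso
        apply hnot
        have h1 := abs_le.1 (LInf_abs_le x n)
        have h2 := mul_le_mul_of_nonneg_right h1.1 hN.le
        have h3 := mul_le_mul_of_nonneg_right h1.2 hN.le
        rw [Finset.mem_Icc]
        constructor
        · rw [Int.le_floor]; push_cast; linarith
        · have : (⌊x n * ((N : ℝ) + 1)⌋ : ℝ) ≤ (K : ℝ) := (Int.floor_le _).trans (by linarith)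
          exact_mod_cast this
    have hd : ‖x - s‖ ≤ 1 / ((N : ℝ) + 1) := by
      apply LInf_norm_le _ _ (by positivity)
      intro n
      rw [lp.coeFn_sub, Pi.sub_apply, hsn]
      have h1 := Int.floor_le (x n * ((N : ℝ) + 1))
      have h2 := Int.lt_floor_add_one (x n * ((N : ℝ) + 1))
      have : x n - (⌊x n * ((N : ℝ) + 1)⌋ : ℝ) / ((N : ℝ) + 1)
          = (x n * ((N : ℝ) + 1) - ⌊x n * ((N : ℝ) + 1)⌋) / ((N : ℝ) + 1) := by
        field_simp
      rw [this, abs_div, abs_of_pos hN]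
      gcongr
      rw [abs_le]; constructor <;> linarith
    have : φ x = φ (x - s) := by rw [map_sub, hs, sub_zero]
    rw [this]
    calc |φ (x - s)| ≤ ‖φ‖ * ‖x - s‖ := φ.le_opNorm _
      _ ≤ _ := by gcongr
  have hlim : Tendsto (fun N : ℕ => ‖φ‖ * (1 / ((N : ℝ) + 1))) atTop (𝓝 (‖φ‖ * 0)) :=
    tendsto_one_div_add_atTop_nhds_zero_nat.const_mul _
  rw [mul_zero] at hlim
  have := ge_of_tendsto' hlim key
  exact abs_eq_zero.1 (le_antisymm this (abs_nonneg _))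

lemma kills_mul (I : Set (Set ℕ)) (hI : IsIdealOmega I) (f : LInf →L[ℝ] ℝ)
    (hv : ∀ A ∈ I, f (indic A) = 0) (A : Set ℕ) (hA : A ∈ I) (y : LInf) :
    f (indic A * y) = 0 := by
  have := clm_eq_zero_of_indic (f.comp (ContinuousLinearMap.mul ℝ LInf (indic A))) (by
    intro B
    simp only [ContinuousLinearMap.comp_apply, ContinuousLinearMap.mul_apply', indic_mul]
    exact hv _ (hI.1 A _ hA Set.inter_subset_left))
  simpa using congrArg (fun g : LInf →L[ℝ] ℝ => g y) this

lemma mem_SLI (I : Set (Set ℕ)) (hI : IsIdealOmega I) (g : LInf →L[ℝ] ℝ)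
    (hpos : ∀ x : LInf, (∀ n, 0 ≤ x n) → 0 ≤ g x) (h1 : g 1 = 1)
    (hv : ∀ A ∈ I, g (indic A) = 0) : g ∈ SLI I := by
  refine ⟨hpos, ?_, hv⟩
  intro x a hx
  have key : ∀ ε > 0, |g x - a| ≤ ‖g‖ * ε := by
    intro ε hε
    obtain ⟨N, hN⟩ := (Metric.tendsto_atTop.1 hx) ε hε
    have hF : (Set.Iio N) ∈ I := hI.2.2.2 _ (Set.finite_Iio N)
    set y : LInf := x - a • 1 with hy
    have e1 : g x - a = g y := by simp [hy, h1]
    have e2 : g y = g (y - indic (Set.Iio N) * y) := by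
      rw [g.map_sub y, kills_mul I hI g hv _ hF, sub_zero]
    rw [e1, e2]
    refine (g.le_opNorm _).trans ?_
    gcongr
    apply LInf_norm_le _ _ hε.le
    intro n
    rw [lp.coeFn_sub, Pi.sub_apply, LInf_mul_apply, indic_apply]
    by_cases hn : n < N
    · simp [hn, hε.le]
    · have := hN n (not_lt.1 hn)
      rw [Real.dist_eq] at this
      have hyn : y n = x n - a := by
        rw [hy, lp.coeFn_sub, Pi.sub_apply, lp.coeFn_smul, Pi.smul_apply, LInf_one_apply]
        simp
      simpa [hn, hyn] using this.le
  have hlim : Tendsto (fun ε : ℝ => ‖g‖ * ε) (𝓝[>] 0) (𝓝 (‖g‖ * 0)) :=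
    (tendsto_nhdsWithin_of_tendsto_nhds tendsto_id).const_mul _
  rw [mul_zero] at hlim
  have := ge_of_tendsto hlim (eventually_nhdsWithin_of_forall (fun ε hε => key ε hε))
  linarith [abs_eq_zero.1 (le_antisymm this (abs_nonneg _))]

lemma SLI_one (I : Set (Set ℕ)) (g : LInf →L[ℝ] ℝ) (hg : g ∈ SLI I) : g 1 = 1 := by
  apply hg.2.1
  simp [LInf_one_apply]

lemma exists_ultralimit (U : Ultrafilter ℕ) (φ : ℕ → LInf →L[ℝ] ℝ) (C : ℝ)
    (hφ : ∀ n, ‖φ n‖ ≤ C) :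
    ∃ ψ : LInf →L[ℝ] ℝ, ∀ x, Tendsto (fun n => φ n x) U (𝓝 (ψ x)) := by
  have hb : ∀ x n, |φ n x| ≤ C * ‖x‖ := by
    intro x n
    refine ((φ n).le_opNorm x).trans ?_
    gcongr
    exact hφ n
  have hex : ∀ x, ∃ l, |l| ≤ C * ‖x‖ ∧ Tendsto (fun n => φ n x) U (𝓝 l) := by
    intro x
    have hc : IsCompact (Set.Icc (-(C * ‖x‖)) (C * ‖x‖)) := isCompact_Icc
    obtain ⟨l, hl, hl2⟩ := hc.ultrafilter_le_nhds (U.map (fun n => φ n x)) (by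
      rw [le_principal_iff]
      exact Filter.mem_map.2 (Filter.univ_mem' (fun n => abs_le.1 (hb x n))))
    exact ⟨l, abs_le.2 hl, hl2⟩
  choose L hL hT using hex
  refine ⟨LinearMap.mkContinuous
    { toFun := L
      map_add' := fun x y => tendsto_nhds_unique (hT (x + y)) (by
        simpa using (hT x).add (hT y))
      map_smul' := fun c x => tendsto_nhds_unique (hT (c • x)) (by
        simpa using (hT x).const_mul c) } C hL, hT⟩

def evalCLM (n : ℕ) : LInf →L[ℝ] ℝ :=
  LinearMap.mkContinuous
    { toFun := fun x => x n
      map_add' := fun x y => by simp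
      map_smul' := fun c x => by simp } 1 (fun x => (LInf_abs_le x n).trans (one_mul _).ge)

lemma exists_SLI (I : Set (Set ℕ)) (hI : IsIdealOmega I) (A : Set ℕ) (hA : A ∉ I) :
    ∃ s ∈ SLI I, s (indic A) = 1 := by
  let D : Filter ℕ :=
    { sets := {B | Bᶜ ∩ A ∈ I}
      univ_sets := by simpa using hI.2.2.2 ∅ Set.finite_empty
      sets_of_superset := by
        rintro B B' hB hBB
        exact hI.1 _ _ hB (Set.inter_subset_inter_left _ (Set.compl_subset_compl.2 hBB))
      inter_sets := by
        intro B B' hB hB'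
        have := hI.2.1 _ _ hB hB'
        rwa [← Set.union_inter_distrib_right, ← Set.compl_inter] at this }
  have hD : D.NeBot := by
    refine Filter.neBot_iff.2 (fun h => ?_)
    rw [← Filter.empty_mem_iff_bot] at h
    have h' : (∅ : Set ℕ)ᶜ ∩ A ∈ I := h
    simp at h'
    exact hA h'
  have hle : (↑(Ultrafilter.of D) : Filter ℕ) ≤ D := Ultrafilter.of_le D
  have hAD : A ∈ D := by
    change Aᶜ ∩ A ∈ I
    simpa using hI.2.2.2 ∅ Set.finite_empty
  obtain ⟨s, hs⟩ := exists_ultralimit (Ultrafilter.of D) evalCLM 1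
    (fun n => LinearMap.mkContinuous_norm_le _ zero_le_one _)
  have hs' : ∀ x : LInf, Tendsto (fun n => x n) (Ultrafilter.of D) (𝓝 (s x)) := hs
  refine ⟨s, mem_SLI I hI s ?_ ?_ ?_, ?_⟩
  · intro x hx
    exact ge_of_tendsto' (hs' x) hx
  · refine tendsto_nhds_unique (hs' 1) ?_
    simp [LInf_one_apply]
  · intro B hB
    refine tendsto_nhds_unique (hs' _) (tendsto_const_nhds.congr' ?_)
    have : Bᶜ ∈ D := by
      change Bᶜᶜ ∩ A ∈ I
      exact hI.1 _ _ hB (by simp)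
    filter_upwards [hle this] with n hn
    have hn' : n ∉ B := hn
    simp [indic_apply, hn']
  · refine tendsto_nhds_unique (hs' _) (tendsto_const_nhds.congr' ?_)
    filter_upwards [hle hAD] with n hn
    simp [indic_apply, hn]

lemma pos_of_unit (g : LInf →L[ℝ] ℝ)
    (h : ∀ x : LInf, (∀ n, 0 ≤ x n ∧ x n ≤ 1) → 0 ≤ g x) :
    ∀ x : LInf, (∀ n, 0 ≤ x n) → 0 ≤ g x := by
  intro x hx
  have hp : 0 < ‖x‖ + 1 := by positivity
  have := h ((‖x‖ + 1)⁻¹ • x) (by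
    intro n
    have h1 := (abs_le.1 (LInf_abs_le x n)).2
    have h2 := hx n
    simp only [lp.coeFn_smul, Pi.smul_apply, smul_eq_mul]
    refine ⟨by positivity, ?_⟩
    rw [inv_mul_le_iff₀ hp]
    linarith)
  rw [map_smul, smul_eq_mul] at this
  exact nonneg_of_mul_nonneg_right this (by positivity)

lemma exists_near (f : LInf →L[ℝ] ℝ) (ε : ℝ) (hε : 0 < ε) :
    ∃ x : LInf, ‖x‖ ≤ 1 ∧ ‖f‖ - ε ≤ f x := by
  by_cases h0 : ‖f‖ - ε ≤ 0
  · exact ⟨0, by simp, by simpa using h0⟩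
  obtain ⟨x, hx, hfx⟩ := f.exists_lt_apply_of_lt_opNorm (r := ‖f‖ - ε) (by linarith)
  rw [Real.norm_eq_abs] at hfx
  rcases le_total 0 (f x) with h | h
  · rw [abs_of_nonneg h] at hfx
    exact ⟨x, hx.le, hfx.le⟩
  · rw [abs_of_nonpos h] at hfx
    exact ⟨-x, by simpa using hx.le, by simpa using hfx.le⟩

lemma exists_jordan (I : Set (Set ℕ)) (hI : IsIdealOmega I) (f : LInf →L[ℝ] ℝ)
    (h0 : f 1 = 0) (hv : ∀ A ∈ I, f (indic A) = 0) :
    ∃ a b : LInf →L[ℝ] ℝ, f = a - b ∧ a 1 = ‖f‖ / 2 ∧ b 1 = ‖f‖ / 2 ∧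
      (∀ x : LInf, (∀ n, 0 ≤ x n) → 0 ≤ a x) ∧ (∀ x : LInf, (∀ n, 0 ≤ x n) → 0 ≤ b x) ∧
      (∀ A ∈ I, a (indic A) = 0) ∧ (∀ A ∈ I, b (indic A) = 0) := by
  have hch : ∀ n : ℕ, ∃ x : LInf, ‖x‖ ≤ 1 ∧ ‖f‖ - 1 / ((n : ℝ) + 1) ≤ f x :=
    fun n => exists_near f _ (by positivity)
  choose x hx hfx using hch
  let U : Ultrafilter ℕ := Ultrafilter.of atTop
  have hU : (U : Filter ℕ) ≤ atTop := Ultrafilter.of_le _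
  have hlim1 : Tendsto (fun n : ℕ => 1 / ((n : ℝ) + 1)) U (𝓝 0) :=
    tendsto_one_div_add_atTop_nhds_zero_nat.mono_left hU
  have hlimf : Tendsto (fun n => f (x n)) U (𝓝 ‖f‖) := by
    refine tendsto_of_tendsto_of_tendsto_of_le_of_le (g := fun n : ℕ => ‖f‖ - 1 / ((n : ℝ) + 1))
      (h := fun _ => ‖f‖) ?_ tendsto_const_nhds hfx ?_
    · simpa using hlim1.const_sub ‖f‖
    · intro n
      calc f (x n) ≤ ‖f (x n)‖ := le_abs_self _
        _ ≤ ‖f‖ * ‖x n‖ := f.le_opNorm _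
        _ ≤ ‖f‖ * 1 := by gcongr; exact hx n
        _ = ‖f‖ := mul_one _
  obtain ⟨m, hm⟩ := exists_ultralimit U
    (fun n => f.comp (ContinuousLinearMap.mul ℝ LInf (x n))) (‖f‖) (by
      intro n
      refine ContinuousLinearMap.opNorm_le_bound _ (norm_nonneg _) (fun z => ?_)
      calc ‖f (x n * z)‖ ≤ ‖f‖ * ‖x n * z‖ := f.le_opNorm _
        _ ≤ ‖f‖ * (‖x n‖ * ‖z‖) := by gcongr; exact norm_mul_le _ _
        _ ≤ ‖f‖ * (1 * ‖z‖) := by gcongr; exact hx n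
        _ = ‖f‖ * ‖z‖ := by rw [one_mul])
  have hm' : ∀ z, Tendsto (fun n => f (x n * z)) U (𝓝 (m z)) := hm
  have m1 : m 1 = ‖f‖ := by
    refine tendsto_nhds_unique (hm' 1) ?_
    simpa using hlimf
  have mv : ∀ A ∈ I, m (indic A) = 0 := by
    intro A hA
    refine tendsto_nhds_unique (hm' _) ?_
    have : ∀ n, f (x n * indic A) = 0 := fun n => by
      rw [mul_comm, kills_mul I hI f hv A hA]
    simp [this]
  have bound : ∀ w : LInf, (∀ n, |w n| ≤ 1) → f w ≤ ‖f‖ := by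
    intro w hw
    calc f w ≤ ‖f w‖ := le_abs_self _
      _ ≤ ‖f‖ * ‖w‖ := f.le_opNorm _
      _ ≤ ‖f‖ * 1 := by gcongr; exact LInf_norm_le _ _ zero_le_one hw
      _ = ‖f‖ := mul_one _
  have posa : ∀ z : LInf, (∀ n, 0 ≤ z n ∧ z n ≤ 1) → 0 ≤ m z + f z := by
    intro z hz
    have key : ∀ n, f (x n) - f (x n * z) - f z ≤ ‖f‖ := by
      intro n
      rw [← map_sub, ← map_sub]
      apply bound
      intro k
      simp only [lp.coeFn_sub, Pi.sub_apply, LInf_mul_apply]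
      have h1 := abs_le.1 ((LInf_abs_le (x n) k).trans (hx n))
      obtain ⟨h2, h3⟩ := hz k
      rw [abs_le]
      constructor <;> nlinarith [h1.1, h1.2]
    have := le_of_tendsto' ((hlimf.sub (hm' z)).sub_const (f z)) key
    linarith
  have posb : ∀ z : LInf, (∀ n, 0 ≤ z n ∧ z n ≤ 1) → 0 ≤ m z - f z := by
    intro z hz
    have key : ∀ n, f (x n) - f (x n * z) + f z ≤ ‖f‖ := by
      intro n
      rw [← map_sub, ← map_add]
      apply bound
      intro k
      simp only [lp.coeFn_sub, lp.coeFn_add, Pi.add_apply, Pi.sub_apply, LInf_mul_apply]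
      have h1 := abs_le.1 ((LInf_abs_le (x n) k).trans (hx n))
      obtain ⟨h2, h3⟩ := hz k
      rw [abs_le]
      constructor <;> nlinarith [h1.1, h1.2]
    have := le_of_tendsto' ((hlimf.sub (hm' z)).add_const (f z)) key
    linarith
  refine ⟨(1 / 2 : ℝ) • (m + f), (1 / 2 : ℝ) • (m - f), ?_, ?_, ?_, ?_, ?_, ?_, ?_⟩
  · ext z; simp; ring
  · simp [m1, h0]; ring
  · simp [m1, h0]; ring
  · apply pos_of_unit
    intro z hz
    have := posa z hz
    simp; linarith
  · apply pos_of_unit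
    intro z hz
    have := posb z hz
    simp; linarith
  · intro A hA; simp [mv A hA, hv A hA]
  · intro A hA; simp [mv A hA, hv A hA]

lemma decomp_of (I : Set (Set ℕ)) (hI : IsIdealOmega I) (a s : LInf →L[ℝ] ℝ) (c : ℝ)
    (hc : c ≤ 1) (a1 : a 1 = c) (ha : ∀ x : LInf, (∀ n, 0 ≤ x n) → 0 ≤ a x)
    (hv : ∀ A ∈ I, a (indic A) = 0) (hs : s ∈ SLI I) : a + (1 - c) • s ∈ SLI I := by
  apply mem_SLI I hI
  · intro x hx
    have h1 := ha x hx
    have h2 := hs.1 x hx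
    have h3 : 0 ≤ 1 - c := by linarith
    simp only [ContinuousLinearMap.add_apply, ContinuousLinearMap.smul_apply, smul_eq_mul]
    positivity
  · simp [a1, SLI_one I s hs]
  · intro A hA
    simp [hv A hA, hs.2.2 A hA]

lemma unique_of_norm (I : Set (Set ℕ)) (f g h g' h' : LInf →L[ℝ] ℝ) (hf : ‖f‖ = 2)
    (hg : g ∈ SLI I) (hh : h ∈ SLI I) (hg' : g' ∈ SLI I) (hh' : h' ∈ SLI I)
    (e : f = g - h) (e' : f = g' - h') : g = g' := by
  have pos_le : ∀ (k : LInf →L[ℝ] ℝ), k ∈ SLI I → ∀ u v : LInf, (∀ n, u n ≤ v n) → k u ≤ k v := by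
    intro k hk u v huv
    have := hk.1 (v - u) (fun n => by simpa using huv n)
    rw [map_sub] at this
    linarith
  rw [← sub_eq_zero]
  apply clm_eq_zero_of_indic
  intro B
  have hz : ∀ n, 0 ≤ indic B n ∧ indic B n ≤ 1 := by
    intro n
    rw [indic_apply]
    by_cases hn : n ∈ B <;> simp [hn]
  generalize indic B = z at hz
  have key : ∀ ε > 0, |(g - g') z| ≤ ε := by
    intro ε hε
    obtain ⟨x, hx, hfx⟩ := exists_near f ε hε
    rw [hf] at hfx
    have hxn : ∀ n, -1 ≤ x n ∧ x n ≤ 1 := fun n => abs_le.1 ((LInf_abs_le x n).trans hx)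
    have up : ∀ k ∈ SLI I, k x ≤ 1 := fun k hk => by
      rw [← SLI_one I k hk]
      exact pos_le k hk _ _ (fun n => by rw [LInf_one_apply]; exact (hxn n).2)
    have lo : ∀ k ∈ SLI I, -1 ≤ k x := fun k hk => by
      have := pos_le k hk (-1) x (fun n => by
        rw [lp.coeFn_neg, Pi.neg_apply, LInf_one_apply]
        exact (hxn n).1)
      rwa [map_neg, SLI_one I k hk] at this
    have bm : ∀ k ∈ SLI I, 0 ≤ k (z * (1 - x)) ∧ k (z * (1 - x)) ≤ 1 - k x := fun k hk => by
      constructor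
      · apply hk.1
        intro n
        simp only [LInf_mul_apply, lp.coeFn_sub, Pi.sub_apply, LInf_one_apply]
        exact mul_nonneg (hz n).1 (by linarith [(hxn n).2])
      · have := pos_le k hk (z * (1 - x)) (1 - x) (fun n => by
          simp only [LInf_mul_apply, lp.coeFn_sub, Pi.sub_apply, LInf_one_apply]
          exact mul_le_of_le_one_left (by linarith [(hxn n).2]) (hz n).2)
        rwa [map_sub, SLI_one I k hk] at this
    have bp : ∀ k ∈ SLI I, 0 ≤ k (z * (1 + x)) ∧ k (z * (1 + x)) ≤ 1 + k x := fun k hk => by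
      constructor
      · apply hk.1
        intro n
        simp only [LInf_mul_apply, lp.coeFn_add, Pi.add_apply, LInf_one_apply]
        exact mul_nonneg (hz n).1 (by linarith [(hxn n).1])
      · have := pos_le k hk (z * (1 + x)) (1 + x) (fun n => by
          simp only [LInf_mul_apply, lp.coeFn_add, Pi.add_apply, LInf_one_apply]
          exact mul_le_of_le_one_left (by linarith [(hxn n).1]) (hz n).2)
        rwa [map_add, SLI_one I k hk] at this
    have e1 : f x = g x - h x := by rw [e]; rfl
    have e2 : f x = g' x - h' x := by rw [e']; rfl
    have hd : ∀ w, g w - g' w = h w - h' w := by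
      intro w
      have : g w - h w = g' w - h' w := by
        rw [← ContinuousLinearMap.sub_apply, ← ContinuousLinearMap.sub_apply, ← e, e']
      linarith
    have hzz : z = (1 / 2 : ℝ) • (z * (1 - x) + z * (1 + x)) := by
      ext n
      simp only [LInf_mul_apply, lp.coeFn_add, lp.coeFn_sub, Pi.sub_apply, Pi.add_apply,
        LInf_one_apply, lp.coeFn_smul, Pi.smul_apply, smul_eq_mul]
      ring
    have hsum : (g - g') z = 1 / 2 * ((g (z * (1 - x)) - g' (z * (1 - x)))
        + (g (z * (1 + x)) - g' (z * (1 + x)))) := by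
      conv_lhs => rw [hzz]
      simp only [ContinuousLinearMap.sub_apply, map_smul, map_add, smul_eq_mul]
      try ring
    rw [hsum, hd (z * (1 + x))]
    have q1 := bm g hg
    have q2 := bm g' hg'
    have q3 := bp h hh
    have q4 := bp h' hh'
    have := up g hg
    have := up g' hg'
    have := lo h hh
    have := lo h' hh'
    rw [abs_le]
    constructor <;> linarith
  exact abs_eq_zero.1 (le_antisymm (le_of_forall_pos_le_add (by simpa using key)) (abs_nonneg _))

theorem stmt13 (I : Set (Set ℕ)) (hI : IsIdealOmega I) (f : LInf →L[ℝ] ℝ)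
    (h0 : f eone = 0) (hn : ‖f‖ ≤ 2) (hv : ∀ A ∈ I, f (indic A) = 0) :
    (∃! gh : (LInf →L[ℝ] ℝ) × (LInf →L[ℝ] ℝ),
        gh.1 ∈ SLI I ∧ gh.2 ∈ SLI I ∧ f = gh.1 - gh.2) ↔
      (‖f‖ = 2 ∨ ∀ A : Set ℕ, A ∈ I ∨ Aᶜ ∈ I) := by
  
  rw [eone_eq] at h0
  obtain ⟨a, b, hab, a1, b1, pa, pb, va, vb⟩ := exists_jordan I hI f h0 hv
  have hc : ‖f‖ / 2 ≤ 1 := by linarith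
  have dec : ∀ s ∈ SLI I, (a + (1 - ‖f‖ / 2) • s) ∈ SLI I ∧ (b + (1 - ‖f‖ / 2) • s) ∈ SLI I ∧
      f = (a + (1 - ‖f‖ / 2) • s) - (b + (1 - ‖f‖ / 2) • s) := by
    intro s hs
    refine ⟨decomp_of I hI a s _ hc a1 pa va hs, decomp_of I hI b s _ hc b1 pb vb hs, ?_⟩
    rw [add_sub_add_right_eq_sub]
    exact hab
  constructor
  · rintro ⟨gh, -, huniq⟩
    by_contra hcon
    push Not at hcon
    obtain ⟨hne, A, hA, hA'⟩ := hcon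
    obtain ⟨s, hs, hs1⟩ := exists_SLI I hI A hA
    obtain ⟨t, ht, ht1⟩ := exists_SLI I hI Aᶜ hA'
    have ht0 : t (indic A) = 0 := by
      rw [indic_compl, map_sub, SLI_one I t ht] at ht1
      linarith
    have p := (huniq (_, _) (dec s hs)).trans (huniq (_, _) (dec t ht)).symm
    have q := congrArg (fun r : (LInf →L[ℝ] ℝ) × (LInf →L[ℝ] ℝ) => r.1 (indic A)) p
    simp [hs1, ht0] at q
    apply hne
    linarith
  · intro hor
    obtain ⟨s, hs, -⟩ := exists_SLI I hI Set.univ hI.2.2.1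
    refine ⟨(_, _), dec s hs, ?_⟩
    rintro ⟨g, h⟩ ⟨hg, hh, e⟩
    obtain ⟨dg, dh, de⟩ := dec s hs
    simp only at hg hh e
    have hgeq : g = a + (1 - ‖f‖ / 2) • s := by
      rcases hor with h2 | hmax
      · exact unique_of_norm I f g h _ _ h2 hg hh dg dh e de
      · rw [← sub_eq_zero]
        apply clm_eq_zero_of_indic
        intro B
        rw [ContinuousLinearMap.sub_apply]
        rcases hmax B with hB | hB
        · rw [hg.2.2 B hB, dg.2.2 B hB, sub_zero]
        · have r1 := hg.2.2 _ hB
          have r2 := dg.2.2 _ hB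
          rw [indic_compl, map_sub, SLI_one I _ hg] at r1
          rw [indic_compl, map_sub, SLI_one I _ dg] at r2
          linarith
    have hheq : h = b + (1 - ‖f‖ / 2) • s := by
      have x1 : h = g - f := by rw [e]; abel
      rw [x1, hgeq]
      conv_lhs => rw [hab]
      rw [← hab]
      nth_rewrite 2 [hab]
      abel
    rw [hgeq, hheq]
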